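/- Let Cl(p,q,r) be a Clifford algebra with n = p+q+r and r ≠ n. The centralizer of the grade-2 subspace equals Λ_r ⊕ Cl^n(p,q,r): an element X satisfies XV = VX for all V in the grade-2 subspace if and only if X is a sum of an element of the subalgebra generated by the null generators and a multiple of the pseudoscalar e_1⋯e_n. -/

import Mathlib

open CliffordAlgebra

noncomputable section

/-- Diagonal weights: `p` entries `+1`, `q` entries `-1`, `r` entries `0`. -/
def cliffSig (p q : ℕ) (i : ℕ) : ℝ := if i < p then 1 else if i < p + q then -1 else 0

/-- The quadratic form of signature `(p, q, r)` on `ℝ^(p+q+r)`. -/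
def Qf (p q r : ℕ) : QuadraticForm ℝ (Fin (p + q + r) → ℝ) :=
  QuadraticMap.weightedSumSquares ℝ (fun i : Fin (p + q + r) => cliffSig p q (i : ℕ))

/-- The `i`-th generator `e_i` of `Cl(p,q,r)`. -/
def gen (p q r : ℕ) (i : Fin (p + q + r)) : CliffordAlgebra (Qf p q r) :=
  ι (Qf p q r) (Pi.single i 1)

/-- The grade-`m` subspace `Cl^m(p,q,r)`: span of products of `m` distinct generators
with increasing indices. -/
def gradeSubspace (p q r m : ℕ) : Submodule ℝ (CliffordAlgebra (Qf p q r)) :=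
  Submodule.span ℝ {x | ∃ l : List (Fin (p + q + r)),
    l.Chain' (· < ·) ∧ l.length = m ∧ x = (l.map (gen p q r)).prod}

/-- `Λ_r`: the subalgebra generated by the `r` null generators. -/
def LambdaR (p q r : ℕ) : Subalgebra ℝ (CliffordAlgebra (Qf p q r)) :=
  Algebra.adjoin ℝ {x | ∃ i : Fin (p + q + r), p + q ≤ (i : ℕ) ∧ x = gen p q r i}

/-- `Λ^d_r`: the degree-`d` component of `Λ_r`. -/
def LambdaDeg (p q r d : ℕ) : Submodule ℝ (CliffordAlgebra (Qf p q r)) :=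
  Submodule.span ℝ {x | ∃ l : List (Fin (p + q + r)),
    l.Chain' (· < ·) ∧ l.length = d ∧ (∀ i ∈ l, p + q ≤ (i : ℕ)) ∧
    x = (l.map (gen p q r)).prod}

/-- The pseudoscalar `e_1 ⋯ e_n`. -/
def pseudoscalar (p q r : ℕ) : CliffordAlgebra (Qf p q r) :=
  ((List.finRange (p + q + r)).map (gen p q r)).prod

section

variable {p q r : ℕ}

theorem gen_mul_self (i : Fin (p + q + r)) :
    gen p q r i * gen p q r i = algebraMap ℝ _ (cliffSig p q i) := by
  rw [gen, ι_sq_scalar]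
  congr 1
  simp [Qf, QuadraticMap.weightedSumSquares_apply, Pi.single_apply]

theorem gen_mul_gen {i j : Fin (p + q + r)} (h : i ≠ j) :
    gen p q r i * gen p q r j = -(gen p q r j * gen p q r i) := by
  rw [eq_neg_iff_add_eq_zero, gen, gen, ι_mul_ι_add_swap]
  have hQ : QuadraticMap.polar (Qf p q r) (Pi.single i 1) (Pi.single j 1) = 0 := by
    rw [QuadraticMap.polar, Qf]
    simp only [QuadraticMap.weightedSumSquares_apply, ← Finset.sum_sub_distrib]
    refine Finset.sum_eq_zero fun k _ => ?_
    by_cases hi : k = i <;> by_cases hj : k = j <;> simp_all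
  rw [hQ, map_zero]

theorem cliffSig_ne_zero {i : ℕ} (h : i < p + q) : cliffSig p q i ≠ 0 := by
  unfold cliffSig
  split_ifs <;> norm_num

theorem cliffSig_eq_zero {i : ℕ} (h : p + q ≤ i) : cliffSig p q i = 0 := by
  rw [cliffSig, if_neg (by omega), if_neg (by omega)]

/-- The product of the generators indexed by a list. -/
def listProd (l : List (Fin (p + q + r))) : CliffordAlgebra (Qf p q r) :=
  (l.map (gen p q r)).prod

theorem listProd_cons (a : Fin (p + q + r)) (l : List (Fin (p + q + r))) :
    listProd (a :: l) = gen p q r a * listProd l := by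
  simp [listProd]

theorem listProd_perm {l m : List (Fin (p + q + r))} (h : l.Perm m) (hl : l.Nodup) :
    listProd l = listProd m ∨ listProd l = -listProd m := by
  induction h with
  | nil => exact Or.inl rfl
  | cons a _ ih =>
    rw [listProd_cons, listProd_cons]
    rcases ih hl.of_cons with h | h <;> simp [h]
  | swap a b l =>
    right
    have hab : b ≠ a := by
      rintro rfl
      simp at hl
    simp only [listProd_cons]
    rw [← mul_assoc, gen_mul_gen hab, neg_mul, mul_assoc]
  | trans h₁ _ ih₁ ih₂ =>
    rcases ih₁ hl with h | h <;> rcases ih₂ (h₁.nodup_iff.mp hl) with h' | h' <;> simp [h, h']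

/-- The span of the products of distinct generators whose index lists satisfy `s`. -/
def listSpan (s : List (Fin (p + q + r)) → Prop) : Submodule ℝ (CliffordAlgebra (Qf p q r)) :=
  Submodule.span ℝ {x | ∃ l : List (Fin (p + q + r)), l.Nodup ∧ s l ∧ x = listProd l}

theorem listProd_mem_listSpan {s : List (Fin (p + q + r)) → Prop} {l : List (Fin (p + q + r))}
    (hl : l.Nodup) (hs : s l) : listProd l ∈ listSpan s :=
  Submodule.subset_span ⟨l, hl, hs, rfl⟩

theorem gen_mul_mem_listSpan (a : Fin (p + q + r)) {x : CliffordAlgebra (Qf p q r)}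
    (hx : x ∈ listSpan (p := p) (q := q) (r := r) fun _ => True) :
    gen p q r a * x ∈ listSpan (p := p) (q := q) (r := r) fun _ => True := by
  induction hx using Submodule.span_induction with
  | zero => simp
  | add x y _ _ hx hy => rw [mul_add]; exact add_mem hx hy
  | smul c x _ hx => rw [mul_smul_comm]; exact Submodule.smul_mem _ c hx
  | mem x hx =>
    obtain ⟨l, hl, -, rfl⟩ := hx
    by_cases ha : a ∈ l
    · have key : gen p q r a * listProd (a :: l.erase a) ∈
          listSpan (p := p) (q := q) (r := r) fun _ => True := by
        rw [listProd_cons, ← mul_assoc, gen_mul_self, ← Algebra.smul_def]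
        exact Submodule.smul_mem _ _ (listProd_mem_listSpan (hl.erase a) trivial)
      rcases listProd_perm (List.perm_cons_erase ha) hl with h | h <;> rw [h]
      · exact key
      · rw [mul_neg]
        exact neg_mem key
    · rw [← listProd_cons]
      exact listProd_mem_listSpan (List.nodup_cons.mpr ⟨ha, hl⟩) trivial

theorem mem_listSpan_true (x : CliffordAlgebra (Qf p q r)) :
    x ∈ listSpan (p := p) (q := q) (r := r) fun _ => True := by
  induction x using CliffordAlgebra.left_induction with
  | algebraMap c =>
    rw [Algebra.algebraMap_eq_smul_one]
    exact Submodule.smul_mem _ _ (listProd_mem_listSpan List.nodup_nil trivial)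
  | add x y hx hy => exact add_mem hx hy
  | ι_mul x m hx =>
    have hm : ι (Qf p q r) m = ∑ i, m i • gen p q r i := by
      conv_lhs => rw [pi_eq_sum_univ' m]
      simp only [map_sum, map_smul, gen]
    rw [hm, Finset.sum_mul]
    refine sum_mem fun i _ => ?_
    rw [smul_mul_assoc]
    exact Submodule.smul_mem _ _ (gen_mul_mem_listSpan i hx)

theorem linearMap_ext_listProd {f g : CliffordAlgebra (Qf p q r) →ₗ[ℝ] CliffordAlgebra (Qf p q r)}
    (h : ∀ l : List (Fin (p + q + r)), l.Nodup → f (listProd l) = g (listProd l)) : f = g := by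
  ext x
  induction mem_listSpan_true x using Submodule.span_induction with
  | zero => simp
  | add x y _ _ hx hy => simp [hx, hy]
  | smul c x _ hx => simp [hx]
  | mem x hx =>
    obtain ⟨l, hl, -, rfl⟩ := hx
    exact h l hl

/-- Contraction by the `a`-th coordinate functional. -/
def contr (a : Fin (p + q + r)) :
    CliffordAlgebra (Qf p q r) →ₗ[ℝ] CliffordAlgebra (Qf p q r) :=
  contractLeft (LinearMap.proj a)

theorem contr_gen_mul_self (a : Fin (p + q + r)) (x : CliffordAlgebra (Qf p q r)) :
    contr a (gen p q r a * x) = x - gen p q r a * contr a x := by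
  rw [contr, gen, contractLeft_ι_mul]
  simp

theorem contr_gen_mul {a b : Fin (p + q + r)} (h : a ≠ b) (x : CliffordAlgebra (Qf p q r)) :
    contr a (gen p q r b * x) = -(gen p q r b * contr a x) := by
  rw [contr, gen, contractLeft_ι_mul]
  simp [h]

theorem contr_listProd {a : Fin (p + q + r)} {l : List (Fin (p + q + r))} (h : a ∉ l) :
    contr a (listProd l) = 0 := by
  induction l with
  | nil => simp [listProd, contr]
  | cons b l ih =>
    rw [List.mem_cons, not_or] at h
    rw [listProd_cons, contr_gen_mul h.1, ih h.2, mul_zero, neg_zero]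

/-- The projection onto the span of the products of generators that contain `e_a`. -/
def genProj (a : Fin (p + q + r)) :
    CliffordAlgebra (Qf p q r) →ₗ[ℝ] CliffordAlgebra (Qf p q r) :=
  LinearMap.mulLeft ℝ (gen p q r a) ∘ₗ contr a

theorem genProj_listProd_of_notMem {a : Fin (p + q + r)} {l : List (Fin (p + q + r))}
    (h : a ∉ l) : genProj a (listProd l) = 0 := by
  simp [genProj, contr_listProd h]

theorem genProj_listProd_of_mem {a : Fin (p + q + r)} {l : List (Fin (p + q + r))}
    (hl : l.Nodup) (h : a ∈ l) : genProj a (listProd l) = listProd l := by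
  have key : genProj a (listProd (a :: l.erase a)) = listProd (a :: l.erase a) := by
    simp [genProj, listProd_cons, contr_gen_mul_self, contr_listProd hl.not_mem_erase]
  rcases listProd_perm (List.perm_cons_erase h) hl with h | h <;> rw [h]
  · exact key
  · rw [map_neg, key]

theorem genProj_listProd (a : Fin (p + q + r)) {l : List (Fin (p + q + r))} (hl : l.Nodup) :
    genProj a (listProd l) = if a ∈ l then listProd l else 0 := by
  split_ifs with h
  · exact genProj_listProd_of_mem hl h
  · exact genProj_listProd_of_notMem h

theorem genProj_comm (a b : Fin (p + q + r)) (x : CliffordAlgebra (Qf p q r)) :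
    genProj a (genProj b x) = genProj b (genProj a x) := by
  refine LinearMap.congr_fun (f := genProj a ∘ₗ genProj b) (g := genProj b ∘ₗ genProj a)
    (linearMap_ext_listProd fun l hl => ?_) x
  by_cases ha : a ∈ l <;> by_cases hb : b ∈ l <;> simp [genProj_listProd, hl, ha, hb]

theorem genProj_genProj (a : Fin (p + q + r)) (x : CliffordAlgebra (Qf p q r)) :
    genProj a (genProj a x) = genProj a x := by
  refine LinearMap.congr_fun (f := genProj a ∘ₗ genProj a) (g := genProj a)
    (linearMap_ext_listProd fun l hl => ?_) x
  by_cases ha : a ∈ l <;> simp [genProj_listProd, hl, ha]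

theorem genProj_mem_listSpan {s : List (Fin (p + q + r)) → Prop} (a : Fin (p + q + r))
    {x : CliffordAlgebra (Qf p q r)} (hx : x ∈ listSpan s) :
    genProj a x ∈ listSpan fun l => a ∈ l ∧ s l := by
  induction hx using Submodule.span_induction with
  | zero => simp
  | add x y _ _ hx hy => rw [map_add]; exact add_mem hx hy
  | smul c x _ hx => rw [map_smul]; exact Submodule.smul_mem _ c hx
  | mem x hx =>
    obtain ⟨l, hl, hs, rfl⟩ := hx
    rw [genProj_listProd a hl]
    split_ifs with ha
    · exact listProd_mem_listSpan hl ⟨ha, hs⟩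
    · exact zero_mem _

theorem sub_genProj_mem_listSpan {s : List (Fin (p + q + r)) → Prop} (a : Fin (p + q + r))
    {x : CliffordAlgebra (Qf p q r)} (hx : x ∈ listSpan s) :
    x - genProj a x ∈ listSpan fun l => a ∉ l ∧ s l := by
  induction hx using Submodule.span_induction with
  | zero => simp
  | add x y _ _ hx hy => rw [map_add, add_sub_add_comm]; exact add_mem hx hy
  | smul c x _ hx => rw [map_smul, ← smul_sub]; exact Submodule.smul_mem _ c hx
  | mem x hx =>
    obtain ⟨l, hl, hs, rfl⟩ := hx
    rw [genProj_listProd a hl]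
    split_ifs with ha
    · rw [sub_self]
      exact zero_mem _
    · rw [sub_zero]
      exact listProd_mem_listSpan hl ⟨ha, hs⟩

theorem mem_listSpan_of_genProj_eq_self {x : CliffordAlgebra (Qf p q r)}
    (t : List (Fin (p + q + r))) (h : ∀ a ∈ t, genProj a x = x) :
    x ∈ listSpan fun l => ∀ a ∈ t, a ∈ l := by
  induction t with
  | nil => simpa using mem_listSpan_true x
  | cons a t ih =>
    have := genProj_mem_listSpan a (ih fun b hb => h b (List.mem_cons_of_mem a hb))
    rw [h a List.mem_cons_self] at this
    simpa using this

theorem mem_listSpan_of_genProj_eq_zero {x : CliffordAlgebra (Qf p q r)}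
    (t : List (Fin (p + q + r))) (h : ∀ a ∈ t, genProj a x = 0) :
    x ∈ listSpan fun l => ∀ a ∈ t, a ∉ l := by
  induction t with
  | nil => simpa using mem_listSpan_true x
  | cons a t ih =>
    have := sub_genProj_mem_listSpan a (ih fun b hb => h b (List.mem_cons_of_mem a hb))
    rw [h a List.mem_cons_self, sub_zero] at this
    simpa using this

theorem exists_eq_smul_pseudoscalar {x : CliffordAlgebra (Qf p q r)}
    (h : ∀ a, genProj a x = x) : ∃ c : ℝ, x = c • pseudoscalar p q r := by
  have hx := mem_listSpan_of_genProj_eq_self (List.finRange _) fun a _ => h a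
  suffices hle : x ∈ Submodule.span ℝ {pseudoscalar p q r} by
    obtain ⟨c, hc⟩ := Submodule.mem_span_singleton.mp hle
    exact ⟨c, hc.symm⟩
  refine Submodule.span_le.mpr ?_ hx
  rintro _ ⟨l, hl, hs, rfl⟩
  have hperm : l.Perm (List.finRange (p + q + r)) :=
    (List.perm_ext_iff_of_nodup hl (List.nodup_finRange _)).mpr fun a =>
      ⟨fun _ => List.mem_finRange a, hs a⟩
  have hmem : listProd (List.finRange (p + q + r)) ∈ Submodule.span ℝ {pseudoscalar p q r} :=
    Submodule.mem_span_singleton_self _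
  rcases listProd_perm hperm hl with h | h <;> rw [h]
  · exact hmem
  · exact neg_mem hmem

theorem mem_LambdaR {x : CliffordAlgebra (Qf p q r)}
    (h : ∀ a : Fin (p + q + r), (a : ℕ) < p + q → genProj a x = 0) : x ∈ LambdaR p q r := by
  have hx := mem_listSpan_of_genProj_eq_zero (x := x)
    ((List.finRange (p + q + r)).filter fun a => (a : ℕ) < p + q) fun a ha => h a (by simpa using ha)
  suffices hle : x ∈ Subalgebra.toSubmodule (LambdaR p q r) from hle
  refine Submodule.span_le.mpr ?_ hx
  rintro _ ⟨l, -, hs, rfl⟩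
  refine Subalgebra.list_prod_mem _ fun y hy => ?_
  obtain ⟨a, ha, rfl⟩ := List.mem_map.mp hy
  refine Algebra.subset_adjoin ⟨a, ?_, rfl⟩
  by_contra! hlt
  exact hs a (by simpa using hlt) ha

theorem commute_gen_mul_gen {a b c : Fin (p + q + r)} (hca : c ≠ a) (hcb : c ≠ b) :
    Commute (gen p q r c) (gen p q r a * gen p q r b) := by
  rw [Commute, SemiconjBy, ← mul_assoc, gen_mul_gen hca, neg_mul, mul_assoc, gen_mul_gen hcb,
    mul_neg, neg_neg, mul_assoc]

theorem commute_listProd {a b : Fin (p + q + r)} {l : List (Fin (p + q + r))}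
    (ha : a ∉ l) (hb : b ∉ l) : Commute (listProd l) (gen p q r a * gen p q r b) := by
  refine (Commute.list_prod_right _ _ fun x hx => ?_).symm
  obtain ⟨c, hc, rfl⟩ := List.mem_map.mp hx
  exact (commute_gen_mul_gen (ne_of_mem_of_not_mem hc ha) (ne_of_mem_of_not_mem hc hb)).symm

theorem commute_listProd_of_mem {a b : Fin (p + q + r)} (hab : a ≠ b)
    {l : List (Fin (p + q + r))} (hl : l.Nodup) (ha : a ∈ l) (hb : b ∈ l) :
    Commute (listProd l) (gen p q r a * gen p q r b) := by
  have hb' : b ∈ l.erase a := (List.mem_erase_of_ne hab.symm).mpr hb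
  have hperm : l.Perm (a :: b :: (l.erase a).erase b) :=
    (List.perm_cons_erase ha).trans ((List.perm_cons_erase hb').cons a)
  have key : Commute (listProd (a :: b :: (l.erase a).erase b)) (gen p q r a * gen p q r b) := by
    rw [listProd_cons, listProd_cons, ← mul_assoc]
    exact (Commute.refl _).mul_left (commute_listProd
      (fun h => hl.not_mem_erase (List.mem_of_mem_erase h)) (hl.erase a).not_mem_erase)
  rcases listProd_perm hperm hl with h | h <;> rw [h]
  · exact key
  · exact key.neg_left

theorem gen_mul_contr_commutator {a b : Fin (p + q + r)} (hab : a ≠ b)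
    (x : CliffordAlgebra (Qf p q r)) :
    gen p q r a * contr b (x * (gen p q r a * gen p q r b) - gen p q r a * gen p q r b * x) =
      (2 * cliffSig p q a) • (genProj a x - genProj b (genProj a x)) := by
  set v := gen p q r a * gen p q r b with hv
  refine LinearMap.congr_fun
    (f := LinearMap.mulLeft ℝ (gen p q r a) ∘ₗ contr b ∘ₗ
      (LinearMap.mulRight ℝ v - LinearMap.mulLeft ℝ v))
    (g := (2 * cliffSig p q a) • (genProj a - genProj b ∘ₗ genProj a))
    (linearMap_ext_listProd fun l hl => ?_) x
  simp only [LinearMap.comp_apply, LinearMap.sub_apply, LinearMap.mulLeft_apply,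
    LinearMap.mulRight_apply, LinearMap.smul_apply]
  by_cases ha : a ∈ l <;> by_cases hb : b ∈ l
  · rw [(commute_listProd_of_mem hab hl ha hb).eq, ← hv]
    simp [genProj_listProd, hl, ha, hb]
  · have hbe : b ∉ l.erase a := fun h => hb (List.mem_of_mem_erase h)
    have hae : a ∉ l.erase a := hl.not_mem_erase
    have key : gen p q r a * contr b (listProd (a :: l.erase a) * v -
        v * listProd (a :: l.erase a)) = (2 * cliffSig p q a) • listProd (a :: l.erase a) := by
      have h₁ : listProd (a :: l.erase a) * v =
          cliffSig p q a • (gen p q r b * listProd (l.erase a)) := by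
        rw [listProd_cons, mul_assoc, (commute_listProd hae hbe).eq, ← mul_assoc, ← mul_assoc,
          gen_mul_self, mul_assoc, Algebra.smul_def]
      have h₂ : v * listProd (a :: l.erase a) =
          -(cliffSig p q a • (gen p q r b * listProd (l.erase a))) := by
        rw [listProd_cons, hv, gen_mul_gen hab, neg_mul, mul_assoc, ← mul_assoc (gen p q r a),
          gen_mul_self, ← Algebra.smul_def, mul_smul_comm]
      rw [h₁, h₂, sub_neg_eq_add, ← add_smul, map_smul, contr_gen_mul_self, contr_listProd hbe,
        mul_zero, sub_zero, mul_smul_comm, ← listProd_cons, two_mul]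
    rw [genProj_listProd_of_mem hl ha, genProj_listProd_of_notMem hb, sub_zero]
    rcases listProd_perm (List.perm_cons_erase ha) hl with h | h <;> rw [h]
    · exact key
    · rw [smul_neg, ← key, ← mul_neg, ← map_neg]
      congr 2
      noncomm_ring
  · have hae : a ∉ l.erase b := fun h => ha (List.mem_of_mem_erase h)
    have hbe : b ∉ l.erase b := hl.not_mem_erase
    have key : contr b (listProd (b :: l.erase b) * v - v * listProd (b :: l.erase b)) = 0 := by
      have h₁ : listProd (b :: l.erase b) * v =
          -(cliffSig p q b • (gen p q r a * listProd (l.erase b))) := by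
        rw [listProd_cons, mul_assoc, (commute_listProd hae hbe).eq, gen_mul_gen hab, neg_mul,
          mul_neg, ← mul_assoc, ← mul_assoc, gen_mul_self, mul_assoc, Algebra.smul_def]
      have h₂ : v * listProd (b :: l.erase b) =
          cliffSig p q b • (gen p q r a * listProd (l.erase b)) := by
        rw [listProd_cons, hv, mul_assoc, ← mul_assoc (gen p q r b),
          gen_mul_self, ← Algebra.smul_def, mul_smul_comm]
      rw [h₁, h₂, map_sub, map_neg, map_smul, contr_gen_mul hab.symm, contr_listProd hbe]
      simp
    rw [genProj_listProd_of_notMem ha, map_zero, sub_zero, smul_zero]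
    rcases listProd_perm (List.perm_cons_erase hb) hl with h | h <;> rw [h]
    · rw [key, mul_zero]
    · rw [neg_mul, mul_neg, ← neg_sub', map_neg, key, neg_zero, mul_zero]
  · rw [(commute_listProd ha hb).eq, ← hv]
    simp [genProj_listProd_of_notMem ha]

theorem commute_of_mem_LambdaR {a b : Fin (p + q + r)} (hab : a ≠ b)
    {x : CliffordAlgebra (Qf p q r)} (hx : x ∈ LambdaR p q r) :
    Commute x (gen p q r a * gen p q r b) := by
  suffices hle : LambdaR p q r ≤ Subalgebra.centralizer ℝ {gen p q r a * gen p q r b} from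
    (Subalgebra.mem_centralizer_iff ℝ |>.mp (hle hx) _ rfl).symm
  refine Algebra.adjoin_le ?_
  rintro _ ⟨c, hc, rfl⟩
  have hsq : gen p q r c * gen p q r c = 0 := by rw [gen_mul_self, cliffSig_eq_zero hc, map_zero]
  rw [SetLike.mem_coe, Subalgebra.mem_centralizer_iff]
  rintro _ rfl
  by_cases hca : c = a
  · subst hca
    rw [← mul_assoc, hsq, zero_mul, gen_mul_gen hab, neg_mul, mul_assoc, hsq, mul_zero, neg_zero]
  · by_cases hcb : c = b
    · subst hcb
      rw [mul_assoc, hsq, mul_zero, gen_mul_gen hab, mul_neg, ← mul_assoc, hsq, zero_mul, neg_zero]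
    · exact (commute_gen_mul_gen hca hcb).eq.symm

theorem forall_mem_gradeSubspace_two_iff {x : CliffordAlgebra (Qf p q r)} :
    (∀ v ∈ gradeSubspace p q r 2, x * v = v * x) ↔
      ∀ a b : Fin (p + q + r), a ≠ b → Commute x (gen p q r a * gen p q r b) := by
  constructor
  · intro h
    have hlt : ∀ a b : Fin (p + q + r), a < b → Commute x (gen p q r a * gen p q r b) :=
      fun a b hab => h _ (Submodule.subset_span ⟨[a, b], List.isChain_pair.mpr hab, rfl, by simp⟩)
    intro a b hab
    rcases lt_or_gt_of_ne hab with h | h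
    · exact hlt a b h
    · rw [gen_mul_gen hab]
      exact (hlt b a h).neg_right
  · intro h v hv
    induction hv using Submodule.span_induction with
    | zero => simp
    | add v w _ _ hv hw => rw [mul_add, add_mul, hv, hw]
    | smul c v _ hv => rw [mul_smul_comm, smul_mul_assoc, hv]
    | mem v hv =>
      obtain ⟨l, hl, hlen, rfl⟩ := hv
      obtain ⟨a, b, rfl⟩ := List.length_eq_two.mp hlen
      have hab : a < b := List.isChain_pair.mp hl
      simpa using (h a b hab.ne).eq

end

/-- For `r ≠ n`, the centralizer of the grade-2 subspace equals `Λ_r ⊕ Cl^n(p,q,r)`. -/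
theorem stmt16 (p q r : ℕ) (hr : r ≠ p + q + r) (X : CliffordAlgebra (Qf p q r)) :
    (∀ V ∈ gradeSubspace p q r 2, X * V = V * X) ↔
      ∃ L : CliffordAlgebra (Qf p q r), L ∈ LambdaR p q r ∧
        ∃ c : ℝ, X = L + c • pseudoscalar p q r := by
  rw [forall_mem_gradeSubspace_two_iff]
  constructor
  · intro h
    have hproj : ∀ a b : Fin (p + q + r), (a : ℕ) < p + q →
        genProj b (genProj a X) = genProj a X := by
      intro a b ha
      obtain rfl | hab := eq_or_ne a b
      · exact genProj_genProj a X
      · have key := gen_mul_contr_commutator hab X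
        rw [(h a b hab).eq, sub_self, map_zero, mul_zero] at key
        have hne : 2 * cliffSig p q a ≠ 0 := mul_ne_zero two_ne_zero (cliffSig_ne_zero ha)
        exact (sub_eq_zero.mp ((smul_eq_zero.mp key.symm).resolve_left hne)).symm
    let o : Fin (p + q + r) := ⟨0, by omega⟩
    have ho : (o : ℕ) < p + q := by
      change 0 < p + q
      omega
    obtain ⟨c, hc⟩ := exists_eq_smul_pseudoscalar fun a => hproj o a ho
    refine ⟨X - genProj o X, mem_LambdaR fun a ha => ?_, c, by rw [← hc, sub_add_cancel]⟩
    rw [map_sub, ← hproj a o ha, genProj_comm, sub_self]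
  · rintro ⟨L, hL, c, rfl⟩ a b hab
    exact (commute_of_mem_LambdaR hab hL).add_left
      ((commute_listProd_of_mem hab (List.nodup_finRange _) (List.mem_finRange a)
        (List.mem_finRange b)).smul_left c)
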